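/- arXiv:0803.0287 — 2 statements merged into one kernel-verified Lean document; each statement's English description precedes it below -/
import Mathlib

section
/- Let M̃ be a finite-dimensional vector space over K = ℂ((t)) and let θ be a K-linear endomorphism of M̃. If U and U′ are two V₀-lattices of (M̃, θ), then dim_ℂ(U/tU) = dim_ℂ(U′/tU′); that is, the complex dimension of U/tU does not depend on the choice of V₀-lattice U. -/
/-!
STATEMENT 1: The complex dimension of U/tU does not depend on the choice of
V₀-lattice U of (M̃, θ).
-/

noncomputable section

/-- The element `t` of `K = ℂ((t))`. -/
def tLS : LaurentSeries ℂ := HahnSeries.single 1 1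

/-- `U` is a V₀-lattice of `(M, θ)`: it is a `ℂ[[t]]`-submodule of `M`, stable under
`tθ`, finitely generated over the algebra `ℂ[[t]][tθ]`, and generates `M` after
inverting `t`. -/
def IsV0Lattice {M : Type*} [AddCommGroup M] [Module (LaurentSeries ℂ) M]
    [Module ℂ M] [IsScalarTower ℂ (LaurentSeries ℂ) M]
    (θ : M →ₗ[LaurentSeries ℂ] M) (U : Submodule ℂ M) : Prop :=
  (∀ f : PowerSeries ℂ, ∀ u ∈ U, ((f : LaurentSeries ℂ) • u) ∈ U) ∧
  (∀ u ∈ U, (tLS • θ) u ∈ U) ∧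
  (∃ s : Finset M, (s : Set M) ⊆ (U : Set M) ∧
    ∀ u ∈ U, u ∈ Submodule.span ℂ
      { y : M | ∃ (f : PowerSeries ℂ) (n : ℕ), ∃ x ∈ s,
          y = (f : LaurentSeries ℂ) • (((tLS • θ) ^ n) x) }) ∧
  (∀ m : M, ∃ n : ℕ, (tLS ^ n) • m ∈ U)

/-- Multiplication by `t`, as a `ℂ`-linear endomorphism of `M`. -/
def tSmul {M : Type*} [AddCommGroup M] [Module (LaurentSeries ℂ) M]
    [Module ℂ M] [IsScalarTower ℂ (LaurentSeries ℂ) M] : M →ₗ[ℂ] M :=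
  (tLS • (LinearMap.id : M →ₗ[LaurentSeries ℂ] M)).restrictScalars ℂ

section RelativeDimension

variable {k V : Type*} [Field k] [AddCommGroup V] [Module k V]

/-- The dimension of the quotient `B ⧸ (A ⊓ B)`. -/
def Submodule.relRank (A B : Submodule k V) : Cardinal :=
  Module.rank k (B ⧸ A.comap B.subtype)

theorem Submodule.relRank_add {A B C : Submodule k V} (hAB : A ≤ B) (hBC : B ≤ C) :
    A.relRank C = B.relRank C + A.relRank B := by
  let g : (C ⧸ A.comap C.subtype) →ₗ[k] (C ⧸ B.comap C.subtype) :=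
    Submodule.factor (Submodule.comap_mono hAB)
  have hg : Function.Surjective g := Submodule.factor_surjective _
  let f : (B ⧸ A.comap B.subtype) →ₗ[k] (C ⧸ A.comap C.subtype) :=
    Submodule.mapQ _ _ (Submodule.inclusion hBC) (fun x hx => hx)
  have hf : Function.Injective f := by
    rw [← LinearMap.ker_eq_bot, LinearMap.ker_eq_bot']
    intro x hx
    obtain ⟨x, rfl⟩ := Submodule.mkQ_surjective _ x
    exact (Submodule.Quotient.mk_eq_zero _).mpr ((Submodule.Quotient.mk_eq_zero _).mp hx : _ ∈ _)
  have hr : LinearMap.range f = LinearMap.ker g := by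
    ext y
    obtain ⟨y, rfl⟩ := Submodule.mkQ_surjective _ y
    constructor
    · rintro ⟨x, hx⟩
      obtain ⟨x, rfl⟩ := Submodule.mkQ_surjective _ x
      rw [← hx]
      exact (Submodule.Quotient.mk_eq_zero (B.comap C.subtype)).mpr x.2
    · intro hy
      exact ⟨Submodule.Quotient.mk
        ⟨y, (Submodule.Quotient.mk_eq_zero (B.comap C.subtype)).mp hy⟩, rfl⟩
  unfold Submodule.relRank
  rw [LinearMap.rank_eq_of_surjective hg, ← hr, (LinearEquiv.ofInjective f hf).rank_eq]

theorem Submodule.relRank_map {ψ : V →ₗ[k] V} (hψ : Function.Injective ψ)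
    (A B : Submodule k V) : (A.map ψ).relRank (B.map ψ) = A.relRank B := by
  let e : B ≃ₗ[k] B.map ψ := Submodule.equivMapOfInjective ψ hψ B
  refine (LinearEquiv.rank_eq (Submodule.Quotient.equiv _ _ e ?_)).symm
  ext y
  obtain ⟨x, rfl⟩ := e.surjective y
  simp only [Submodule.mem_map, Submodule.mem_comap, Submodule.subtype_apply]
  constructor
  · rintro ⟨z, hz, hzx⟩
    exact ⟨z, hz, congrArg Subtype.val hzx⟩
  · rintro ⟨z, hz, hzx⟩
    have : z = x := hψ hzx
    exact ⟨x, this ▸ hz, rfl⟩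

theorem Submodule.map_pow_le {φ : V →ₗ[k] V} {U : Submodule k V} (h : U.map φ ≤ U) (n : ℕ) :
    U.map (φ ^ n) ≤ U := by
  rintro _ ⟨u, hu, rfl⟩
  exact Module.End.pow_apply_mem_of_forall_mem n (fun u hu => h ⟨u, hu, rfl⟩) u hu

theorem Submodule.relRank_map_pow_lt {φ : V →ₗ[k] V} (hφ : Function.Injective φ)
    {U : Submodule k V} (h : U.map φ ≤ U) (hfin : (U.map φ).relRank U < Cardinal.aleph0) (n : ℕ) :
    (U.map (φ ^ n)).relRank U < Cardinal.aleph0 := by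
  induction n with
  | zero =>
    refine lt_of_eq_of_lt (b := 0) ?_ Cardinal.aleph0_pos
    rw [pow_zero, Module.End.one_eq_id, Submodule.map_id, Submodule.relRank]
    have : Subsingleton (U ⧸ U.comap U.subtype) := by
      rw [Submodule.Quotient.subsingleton_iff]
      simp
    exact rank_subsingleton' _ _
  | succ n ih =>
    rw [pow_succ', Module.End.mul_eq_comp, Submodule.map_comp,
      Submodule.relRank_add (Submodule.map_mono (Submodule.map_pow_le h n)) h,
      Submodule.relRank_map hφ]
    exact Cardinal.add_lt_aleph0 hfin ih

/-- Two `φ`-stable subspaces that are commensurable up to powers of the injective endomorphism `φ`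
have cokernels of `φ` of the same dimension. -/
theorem Submodule.relRank_map_eq {φ : V →ₗ[k] V} (hφ : Function.Injective φ)
    {U U' : Submodule k V} (h : U.map φ ≤ U) (h' : U'.map φ ≤ U')
    (hfin : (U.map φ).relRank U < Cardinal.aleph0)
    {a b : ℕ} (ha : U'.map (φ ^ a) ≤ U) (hb : U.map (φ ^ b) ≤ U') :
    (U.map φ).relRank U = (U'.map φ).relRank U' := by
  have hinj : Function.Injective (φ ^ a) := by
    rw [Module.End.coe_pow]; exact hφ.iterate a
  have hcomm : (U'.map (φ ^ a)).map φ = (U'.map φ).map (φ ^ a) := by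
    rw [← Submodule.map_comp, ← Submodule.map_comp, ← Module.End.mul_eq_comp,
      ← Module.End.mul_eq_comp, ← pow_succ, ← pow_succ']
  have hV : ((U'.map (φ ^ a)).map φ).relRank (U'.map (φ ^ a)) = (U'.map φ).relRank U' := by
    rw [hcomm, Submodule.relRank_map hinj]
  rw [← hV]
  have hVs : (U'.map (φ ^ a)).map φ ≤ U'.map (φ ^ a) := by
    rw [hcomm]; exact Submodule.map_mono h'
  have hbV : U.map (φ ^ (a + b)) ≤ U'.map (φ ^ a) := by
    rw [pow_add, Module.End.mul_eq_comp, Submodule.map_comp]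
    exact Submodule.map_mono hb
  generalize U'.map (φ ^ a) = W at ha hVs hbV
  have hlt : W.relRank U < Cardinal.aleph0 := by
    refine lt_of_le_of_lt ?_ (Submodule.relRank_map_pow_lt hφ h hfin (a + b))
    rw [Submodule.relRank_add hbV ha]
    exact self_le_add_right _ _
  have h1 := Submodule.relRank_add hVs ha
  rw [Submodule.relRank_add (Submodule.map_mono ha) h, Submodule.relRank_map hφ,
    add_comm] at h1
  exact Cardinal.eq_of_add_eq_add_left h1 hlt

theorem Submodule.relRank_lt_aleph0 {A B F : Submodule k V} (hF : F.FG) (hFB : F ≤ B)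
    (h : B ≤ A ⊔ F) : A.relRank B < Cardinal.aleph0 := by
  have : Module.Finite k F := Module.Finite.iff_fg.mpr hF
  have : Module.Finite k (B ⧸ A.comap B.subtype) := by
    refine Module.Finite.of_surjective
      ((A.comap B.subtype).mkQ ∘ₗ Submodule.inclusion hFB) fun y => ?_
    obtain ⟨y, rfl⟩ := Submodule.mkQ_surjective _ y
    obtain ⟨a, ha, f, hf, hy⟩ := Submodule.mem_sup.mp (h y.2)
    refine ⟨⟨f, hf⟩, ?_⟩
    rw [LinearMap.comp_apply, ← sub_eq_zero, ← map_sub, Submodule.mkQ_apply,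
      Submodule.Quotient.mk_eq_zero]
    change f - y ∈ A
    rw [← hy]
    simpa using ha
  exact Module.rank_lt_aleph0 k _

/-- If `p ≠ 0` and `p(x)` maps `U` into `A`, then modulo `A` every `xⁿ y` with `y ∈ U` is a
combination of the `xⁱ y` with `i < deg p`. -/
theorem Submodule.pow_apply_mem_sup_span {x : Module.End k V} {U A : Submodule k V}
    (hx : ∀ u ∈ U, x u ∈ U) {p : Polynomial k} (hp : p ≠ 0)
    (hpA : ∀ u ∈ U, Polynomial.aeval x p u ∈ A) {s : Set V} {y : V} (hys : y ∈ s) (hy : y ∈ U)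
    (n : ℕ) :
    (x ^ n) y ∈ A ⊔ Submodule.span k
      (Set.image2 (fun (i : ℕ) (y : V) => (x ^ i) y) (Finset.range (p.natDegree + 1)) s) := by
  have hstable : ∀ g : Polynomial k, Polynomial.aeval x g y ∈ U := by
    intro g
    rw [Polynomial.aeval_eq_sum_range, LinearMap.sum_apply]
    refine Submodule.sum_mem _ fun i _ => ?_
    rw [LinearMap.smul_apply]
    exact U.smul_mem _ (Module.End.pow_apply_mem_of_forall_mem i hx y hy)
  have hdiv : (x ^ n) y = Polynomial.aeval x p (Polynomial.aeval x (Polynomial.X ^ n / p) y) +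
      Polynomial.aeval x (Polynomial.X ^ n % p) y := by
    rw [← Module.End.mul_apply, ← map_mul, ← LinearMap.add_apply, ← map_add,
      EuclideanDomain.div_add_mod]
    simp
  rw [hdiv]
  refine Submodule.add_mem_sup (hpA _ (hstable _)) ?_
  rw [Polynomial.aeval_eq_sum_range, LinearMap.sum_apply]
  refine Submodule.sum_mem _ fun i hi => ?_
  rw [LinearMap.smul_apply]
  refine Submodule.smul_mem _ _ (Submodule.subset_span ⟨i, ?_, y, hys, rfl⟩)
  have hdeg : (Polynomial.X ^ n % p).natDegree ≤ p.natDegree :=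
    Polynomial.natDegree_le_natDegree (EuclideanDomain.mod_lt _ hp).le
  simp only [Finset.coe_range, Set.mem_Iio, Finset.mem_range] at hi ⊢
  omega

end RelativeDimension

section Lattices

variable {M : Type*} [AddCommGroup M] [Module (LaurentSeries ℂ) M]

theorem coe_powerSeries_X : ((PowerSeries.X : PowerSeries ℂ) : LaurentSeries ℂ) = tLS :=
  HahnSeries.ofPowerSeries_X

theorem tLS_ne_zero : tLS ≠ 0 :=
  HahnSeries.single_ne_zero one_ne_zero

/-- Every endomorphism is annihilated by a polynomial with power series coefficients whose
reduction modulo `t` is nonzero. -/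
theorem exists_annihilating_polynomial [FiniteDimensional (LaurentSeries ℂ) M]
    (x : Module.End (LaurentSeries ℂ) M) :
    ∃ q : Polynomial (PowerSeries ℂ), q.map (PowerSeries.constantCoeff (R := ℂ)) ≠ 0 ∧
      Polynomial.aeval x (q.map (algebraMap (PowerSeries ℂ) (LaurentSeries ℂ))) = 0 := by
  classical
  let _ : NormalizedGCDMonoid (PowerSeries ℂ) :=
    UniqueFactorizationMonoid.toNormalizedGCDMonoid _
  let r := IsLocalization.integerNormalization (nonZeroDivisors (PowerSeries ℂ)) x.charpoly
  have hr : Polynomial.aeval x (r.map (algebraMap (PowerSeries ℂ) (LaurentSeries ℂ))) = 0 := by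
    obtain ⟨b, -, hb⟩ := IsLocalization.integerNormalization_spec
      (nonZeroDivisors (PowerSeries ℂ)) x.charpoly
    rw [hb, algebra_compatible_smul (LaurentSeries ℂ), Polynomial.smul_eq_C_mul, map_mul,
      LinearMap.aeval_self_charpoly, mul_zero]
  have hr0 : r ≠ 0 := by
    exact mt IsFractionRing.integerNormalization_eq_zero_iff.mp x.charpoly_monic.ne_zero
  refine ⟨r.primPart, fun h => ?_, ?_⟩
  · refine PowerSeries.X_prime.not_isUnit
      (r.isPrimitive_primPart PowerSeries.X ?_)
    rw [Polynomial.C_dvd_iff_dvd_coeff]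
    intro i
    rw [PowerSeries.X_dvd_iff]
    simpa using congrArg (fun p => Polynomial.coeff p i) h
  · rw [r.eq_C_content_mul_primPart, Polynomial.map_mul, Polynomial.map_C, map_mul,
      Polynomial.aeval_C, ← Algebra.smul_def] at hr
    refine (smul_eq_zero.mp hr).resolve_left ?_
    exact fun h => hr0 (Polynomial.content_eq_zero_iff.mp (IsFractionRing.to_map_eq_zero_iff.mp h))

theorem pow_apply_mem_of_stable [Module ℂ M] {U : Submodule ℂ M} {x : Module.End (LaurentSeries ℂ) M}
    (hx : ∀ u ∈ U, x u ∈ U) (n : ℕ) {u : M} (hu : u ∈ U) : (x ^ n) u ∈ U := by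
  induction n with
  | zero => exact hu
  | succ n ih => rw [pow_succ', Module.End.mul_apply]; exact hx _ ih

variable [Module ℂ M] [IsScalarTower ℂ (LaurentSeries ℂ) M]

theorem tSmul_apply (m : M) : tSmul m = tLS • m := rfl

theorem tSmul_pow_apply (n : ℕ) (m : M) : (tSmul ^ n) m = tLS ^ n • m := by
  induction n with
  | zero => simp
  | succ n ih => rw [pow_succ', Module.End.mul_apply, ih, tSmul_apply, smul_smul, pow_succ']

theorem tSmul_injective : Function.Injective (tSmul : M →ₗ[ℂ] M) := fun _ _ h =>
  smul_right_injective M tLS_ne_zero h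

theorem C_smul_eq_smul (c : ℂ) (m : M) : (HahnSeries.C c : LaurentSeries ℂ) • m = c • m := by
  have h := smul_assoc c (1 : LaurentSeries ℂ) m
  rw [one_smul] at h
  rw [← h]
  congr 1
  ext n
  simp [HahnSeries.coeff_one, HahnSeries.coeff_single]

theorem coe_powerSeries_smul_sub_mem {U : Submodule ℂ M}
    (hU : ∀ f : PowerSeries ℂ, ∀ u ∈ U, ((f : LaurentSeries ℂ) • u) ∈ U)
    (f : PowerSeries ℂ) {u : M} (hu : u ∈ U) :
    (f : LaurentSeries ℂ) • u - PowerSeries.constantCoeff f • u ∈ U.map tSmul := by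
  obtain ⟨g, hg⟩ : PowerSeries.X ∣ f - PowerSeries.C (PowerSeries.constantCoeff f) := by
    rw [PowerSeries.X_dvd_iff]; simp
  refine ⟨(g : LaurentSeries ℂ) • u, hU g u hu, ?_⟩
  have hc : PowerSeries.constantCoeff f • u =
      ((PowerSeries.C (PowerSeries.constantCoeff f) : PowerSeries ℂ) : LaurentSeries ℂ) • u := by
    rw [HahnSeries.ofPowerSeries_C, C_smul_eq_smul]
  rw [tSmul_apply, smul_smul, hc, ← sub_smul, ← coe_powerSeries_X, ← map_mul, ← map_sub, hg]

theorem aeval_reduction_sub_mem {U : Submodule ℂ M} {x : Module.End (LaurentSeries ℂ) M}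
    (hU : ∀ f : PowerSeries ℂ, ∀ u ∈ U, ((f : LaurentSeries ℂ) • u) ∈ U)
    (hx : ∀ u ∈ U, x u ∈ U) (q : Polynomial (PowerSeries ℂ)) {u : M} (hu : u ∈ U) :
    Polynomial.aeval x (q.map (algebraMap (PowerSeries ℂ) (LaurentSeries ℂ))) u -
      Polynomial.aeval (R := ℂ) (A := Module.End ℂ M) (x.restrictScalars ℂ)
        (q.map (PowerSeries.constantCoeff (R := ℂ))) u ∈ U.map tSmul := by
  induction q using Polynomial.induction_on' with
  | add p q hp hq =>
    simp only [Polynomial.map_add, map_add, LinearMap.add_apply]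
    rw [add_sub_add_comm]
    exact add_mem hp hq
  | monomial n f =>
    have hpow : ((x.restrictScalars ℂ : Module.End ℂ M) ^ n) u = (x ^ n) u := by
      simp [Module.End.pow_apply]
    simp only [Polynomial.map_monomial, Polynomial.aeval_monomial, Module.End.mul_apply, hpow,
      Module.algebraMap_end_apply]
    exact coe_powerSeries_smul_sub_mem hU f (pow_apply_mem_of_stable hx n hu)

namespace IsV0Lattice

variable {θ : M →ₗ[LaurentSeries ℂ] M} {U U' : Submodule ℂ M}

theorem map_tSmul_le (hU : IsV0Lattice θ U) : U.map tSmul ≤ U := by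
  rintro _ ⟨u, hu, rfl⟩
  rw [tSmul_apply, ← coe_powerSeries_X]
  exact hU.1 _ u hu

theorem relRank_lt_aleph0 [FiniteDimensional (LaurentSeries ℂ) M] (hU : IsV0Lattice θ U) :
    (U.map tSmul).relRank U < Cardinal.aleph0 := by
  obtain ⟨hO, hx, ⟨s, hsU, hs⟩, -⟩ := hU
  obtain ⟨q, hq0, hq⟩ := exists_annihilating_polynomial (tLS • θ)
  let y : Module.End ℂ M := (tLS • θ).restrictScalars ℂ
  have hqA : ∀ u ∈ U,
      Polynomial.aeval y (q.map (PowerSeries.constantCoeff (R := ℂ))) u ∈ U.map tSmul := by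
    intro u hu
    have := aeval_reduction_sub_mem hO hx q hu
    rw [hq, LinearMap.zero_apply, zero_sub] at this
    exact neg_mem_iff.mp this
  set d := (q.map (PowerSeries.constantCoeff (R := ℂ))).natDegree + 1
  refine Submodule.relRank_lt_aleph0 (F := Submodule.span ℂ
      (Set.image2 (fun (i : ℕ) (m : M) => (y ^ i) m) (Finset.range d) s))
    (Submodule.fg_span ((Finset.finite_toSet _).image2 _ s.finite_toSet)) ?_ fun u hu => ?_
  · rw [Submodule.span_le]
    rintro _ ⟨i, -, m, hm, rfl⟩
    exact Module.End.pow_apply_mem_of_forall_mem i hx m (hsU hm)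
  · refine Submodule.span_le.mpr ?_ (hs u hu)
    rintro _ ⟨f, n, m, hm, rfl⟩
    have hpow : (y ^ n) m = ((tLS • θ) ^ n) m := by
      simp [y, Module.End.pow_apply]
    have hmem : ((tLS • θ) ^ n) m ∈ U :=
      pow_apply_mem_of_stable hx n (hsU hm)
    have h1 := coe_powerSeries_smul_sub_mem hO f hmem
    have h2 := Submodule.pow_apply_mem_sup_span (x := y) hx hq0 hqA hm (hsU hm) n
    rw [hpow] at h2
    have h3 := add_mem (Submodule.mem_sup_left h1)
      (Submodule.smul_mem _ (PowerSeries.constantCoeff f) h2)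
    rwa [sub_add_cancel] at h3

theorem exists_map_pow_le (hU : IsV0Lattice θ U) (hU' : IsV0Lattice θ U') :
    ∃ a : ℕ, U'.map (tSmul ^ a) ≤ U := by
  obtain ⟨-, -, ⟨s, -, hs⟩, -⟩ := hU'
  choose n hn using hU.2.2.2
  refine ⟨s.sup n, Submodule.map_le_iff_le_comap.mpr fun u hu => ?_⟩
  refine Submodule.span_le.mpr ?_ (hs u hu)
  rintro _ ⟨f, i, m, hm, rfl⟩
  have ht : tLS ^ s.sup n • m ∈ U := by
    rw [← Nat.sub_add_cancel (Finset.le_sup hm : n m ≤ s.sup n), pow_add, ← smul_smul,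
      ← tSmul_pow_apply]
    exact Submodule.map_pow_le hU.map_tSmul_le _ ⟨_, hn m, rfl⟩
  rw [SetLike.mem_coe, Submodule.mem_comap, tSmul_pow_apply, smul_comm, ← map_smul]
  exact hU.1 f _ (pow_apply_mem_of_stable hU.2.1 i ht)

end IsV0Lattice

end Lattices

theorem v0Lattice_quotient_dim_independent
    {M : Type*} [AddCommGroup M] [Module (LaurentSeries ℂ) M]
    [Module ℂ M] [IsScalarTower ℂ (LaurentSeries ℂ) M]
    [FiniteDimensional (LaurentSeries ℂ) M]
    (θ : M →ₗ[LaurentSeries ℂ] M) (U U' : Submodule ℂ M)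
    (hU : IsV0Lattice θ U) (hU' : IsV0Lattice θ U') :
    Module.finrank ℂ (U ⧸ ((U.map tSmul).comap U.subtype)) =
      Module.finrank ℂ (U' ⧸ ((U'.map tSmul).comap U'.subtype)) := by
  obtain ⟨a, ha⟩ := hU.exists_map_pow_le hU'
  obtain ⟨b, hb⟩ := hU'.exists_map_pow_le hU
  exact congrArg Cardinal.toNat (Submodule.relRank_map_eq tSmul_injective hU.map_tSmul_le
    hU'.map_tSmul_le hU.relRank_lt_aleph0 ha hb)

end
end

section
/- For every d ≥ 1 and every d×d matrix A with entries in ℂ((t)), there exist an integer q ≥ 1, an invertible matrix P ∈ GL_d(ℂ((s))), a finite family of pairwise distinct Laurent polynomials φ₁, …, φ_r ∈ s⁻¹ℂ[s⁻¹] (polynomials in s⁻¹ without constant term, one of which may be 0), and square matrices B₁, …, B_r with entries in ℂ[[s]], such that P⁻¹ · ρ_q(A) · P is the block-diagonal matrix with j-th block s·φ_j′(s)·Id + B_j. (This is the unique coarser decomposition (M̃_q, t_qθ_q) ≅ ⊕_φ (E^{φ/ħ}|_{ħ=0} ⊗ R̃_φ) of the ramified Higgs module into exponentially twisted regular pieces,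 a block with entries in ℂ[[s]] being the matrix of t_qθ_q on a regular Higgs bundle in a suitable basis.) -/
/-!
STATEMENT 5: After a suitable ramification t = s^q, any matrix A over ℂ((t)) (the
matrix of tθ of a meromorphic Higgs bundle) can be conjugated over ℂ((s)) to a
block-diagonal matrix whose j-th block is s·φⱼ′(s)·Id + Bⱼ, where the φⱼ are
pairwise distinct elements of s⁻¹ℂ[s⁻¹] and Bⱼ has entries in ℂ[[s]].
-/

noncomputable section

/-- The ramification `ρ_q : ℂ((t)) → ℂ((s))`, `t ↦ s^q`, as a ring homomorphism of
Laurent series. -/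
def ramify (q : ℕ) (hq : 0 < q) : LaurentSeries ℂ →+* LaurentSeries ℂ :=
  HahnSeries.embDomainRingHom (AddMonoidHom.mulLeft (q : ℤ))
    (mul_right_injective₀ (by exact_mod_cast hq.ne'))
    (fun g g' => ⟨fun h => le_of_mul_le_mul_left h (by exact_mod_cast hq),
      fun h => mul_le_mul_of_nonneg_left h (by positivity)⟩)

/-- For a polynomial `p` with `p.coeff 0 = 0`, encoding the Laurent polynomial
`φ(s) = p(s⁻¹) ∈ s⁻¹ℂ[s⁻¹]`, this is the Laurent series `s·φ′(s) = ∑ₖ (-k)·(p.coeff k)·s⁻ᵏ`. -/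
def sPhiDeriv (p : Polynomial ℂ) : LaurentSeries ℂ :=
  ∑ k ∈ p.support, HahnSeries.single (-(k : ℤ)) (-(k : ℂ) * p.coeff k)

section NewtonPuiseux

open Polynomial
open scoped Ring

/-- Hensel's lemma for polynomials that are not assumed to be monic. -/
theorem IsAdicComplete.exists_isRoot_sub_mem {R : Type*} [CommRing R] (I : Ideal R)
    [IsAdicComplete I R] (f : R[X]) (a₀ : R) (h₁ : f.eval a₀ ∈ I)
    (h₂ : IsUnit (f.derivative.eval a₀)) : ∃ a : R, f.IsRoot a ∧ a - a₀ ∈ I := by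
  classical
  let f' := derivative f
  let c : ℕ → R := fun n => Nat.recOn n a₀ fun _ b => b - f.eval b * (f'.eval b)⁻¹ʳ
  have hc : ∀ n, c (n + 1) = c n - f.eval (c n) * (f'.eval (c n))⁻¹ʳ := by
    intro n
    simp only [c]
  have hc_mod : ∀ n, c n ≡ a₀ [SMOD I] := by
    intro n
    induction n with
    | zero => rfl
    | succ n ih => ?_
    rw [hc, sub_eq_add_neg, ← add_zero a₀]
    refine ih.add ?_
    rw [SModEq.zero, Ideal.neg_mem_iff]
    refine I.mul_mem_right _ ?_
    rw [← SModEq.zero] at h₁ ⊢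
    exact (ih.eval f).trans h₁
  have hf'c : ∀ n, IsUnit (f'.eval (c n)) := by
    intro n
    have := isLocalHom_of_le_jacobson_bot I (IsAdicComplete.le_jacobson_bot I)
    apply IsUnit.of_map (Ideal.Quotient.mk I)
    convert! h₂.map (Ideal.Quotient.mk I) using 1
    exact SModEq.def.mp ((hc_mod n).eval _)
  have hfcI : ∀ n, f.eval (c n) ∈ I ^ (n + 1) := by
    intro n
    induction n with
    | zero => simpa only [Nat.rec_zero, zero_add, pow_one] using! h₁
    | succ n ih => ?_
    rw [← taylor_eval_sub (c n), hc, sub_eq_add_neg, sub_eq_add_neg,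
      add_neg_cancel_comm]
    rw [eval_eq_sum, sum_over_range' _ _ _ (lt_add_of_pos_right _ zero_lt_two), ←
      Finset.sum_range_add_sum_Ico _ (Nat.le_add_left _ _)]
    swap
    · intro i
      rw [zero_mul]
    refine Ideal.add_mem _ ?_ ?_
    · rw [← one_add_one_eq_two, Finset.sum_range_succ, Finset.range_one, Finset.sum_singleton,
        taylor_coeff_zero, taylor_coeff_one, pow_zero, pow_one, mul_one, mul_neg,
        mul_left_comm, Ring.mul_inverse_cancel _ (hf'c n), mul_one, add_neg_cancel]
      exact Ideal.zero_mem _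
    · refine Submodule.sum_mem _ ?_
      simp only [Finset.mem_Ico]
      rintro i ⟨h2i, _⟩
      have aux : n + 2 ≤ i * (n + 1) := by trans 2 * (n + 1) <;> nlinarith only [h2i]
      refine Ideal.mul_mem_left _ _ (Ideal.pow_le_pow_right aux ?_)
      rw [pow_mul']
      exact Ideal.pow_mem_pow ((Ideal.neg_mem_iff _).2 <| Ideal.mul_mem_right _ _ ih) _
  have aux : ∀ m n, m ≤ n → c m ≡ c n [SMOD (I ^ m • ⊤ : Ideal R)] := by
    intro m n hmn
    rw [← Ideal.one_eq_top, Ideal.smul_eq_mul, mul_one]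
    obtain ⟨k, rfl⟩ := Nat.exists_eq_add_of_le hmn
    clear hmn
    induction k with
    | zero => rw [add_zero]
    | succ k ih => ?_
    rw [← add_assoc, hc, ← add_zero (c m), sub_eq_add_neg]
    refine ih.add ?_
    symm
    rw [SModEq.zero, Ideal.neg_mem_iff]
    refine Ideal.mul_mem_right _ _ (Ideal.pow_le_pow_right ?_ (hfcI _))
    rw [add_assoc]
    exact le_self_add
  obtain ⟨a, ha⟩ := IsPrecomplete.prec' c (aux _ _)
  refine ⟨a, ?_, ?_⟩
  · show f.IsRoot a
    suffices ∀ n, f.eval a ≡ 0 [SMOD (I ^ n • ⊤ : Ideal R)] by exact IsHausdorff.haus' _ this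
    intro n
    specialize ha n
    rw [← Ideal.one_eq_top, Ideal.smul_eq_mul, mul_one] at ha ⊢
    refine (ha.symm.eval f).trans ?_
    rw [SModEq.zero]
    exact Ideal.pow_le_pow_right le_self_add (hfcI _)
  · show a - a₀ ∈ I
    specialize ha (0 + 1)
    rw [hc, pow_one, ← Ideal.one_eq_top, Ideal.smul_eq_mul, mul_one, sub_eq_add_neg] at ha
    rw [← SModEq.sub_mem, ← add_zero a₀]
    refine ha.symm.trans (SModEq.rfl.add ?_)
    rw [SModEq.zero, Ideal.neg_mem_iff]
    exact Ideal.mul_mem_right _ _ h₁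

theorem powerSeries_exists_root_of_coeff (h : (PowerSeries ℂ)[X])
    (h0 : PowerSeries.constantCoeff (h.coeff 0) = 0)
    (h1 : PowerSeries.constantCoeff (h.coeff 1) ≠ 0) :
    ∃ x : PowerSeries ℂ, PowerSeries.constantCoeff x = 0 ∧ h.eval x = 0 := by
  obtain ⟨x, hx, hx'⟩ := IsAdicComplete.exists_isRoot_sub_mem
    (Ideal.span {(PowerSeries.X : PowerSeries ℂ)}) h 0
    (by rwa [← coeff_zero_eq_eval_zero, Ideal.mem_span_singleton, PowerSeries.X_dvd_iff])
    (by
      rw [← coeff_zero_eq_eval_zero, coeff_derivative, PowerSeries.isUnit_iff_constantCoeff]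
      simpa using h1)
  refine ⟨x, ?_, hx⟩
  rwa [sub_zero, Ideal.mem_span_singleton, PowerSeries.X_dvd_iff] at hx'

/-- One step of the Newton polygon algorithm. -/
theorem powerSeries_exists_newton_step {m : ℕ} (f : (PowerSeries ℂ)[X])
    (hlt : ∀ i < m, PowerSeries.constantCoeff (f.coeff i) = 0)
    (hm : PowerSeries.constantCoeff (f.coeff m) ≠ 0)
    (hpred : f.coeff (m - 1) = 0) (h0 : f.coeff 0 ≠ 0) (hm0 : 0 < m) :
    ∃ (q : ℕ) (hq : q ≠ 0) (w : ℕ) (g : (PowerSeries ℂ)[X]),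
      (f.map (PowerSeries.expand q hq).toRingHom).comp (C (PowerSeries.X ^ w) * X) =
        C (PowerSeries.X ^ (w * m)) * g ∧
      PowerSeries.constantCoeff (g.coeff m) ≠ 0 ∧
      (∀ i, m < i → PowerSeries.constantCoeff (g.coeff i) = 0) ∧
      g.coeff (m - 1) = 0 ∧ ∃ i < m, PowerSeries.constantCoeff (g.coeff i) ≠ 0 := by
  classical
  let v : ℕ → ℕ := fun i => (f.coeff i).order.toNat
  have hv : ∀ i, f.coeff i ≠ 0 → ∃ u, f.coeff i = PowerSeries.X ^ v i * u ∧
      PowerSeries.constantCoeff u ≠ 0 := by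
    intro i hi
    refine ⟨PowerSeries.divXPowOrder (f.coeff i),
      (PowerSeries.X_pow_order_mul_divXPowOrder).symm, ?_⟩
    rwa [Ne, PowerSeries.constantCoeff_divXPowOrder_eq_zero_iff]
  obtain ⟨j, hj, hmin⟩ := Finset.exists_min_image
    ((Finset.range m).filter fun i => f.coeff i ≠ 0)
    (fun i => (v i : ℚ) / ((m : ℚ) - i)) ⟨0, by simp [hm0, h0]⟩
  obtain ⟨hjm, hj0⟩ : j < m ∧ f.coeff j ≠ 0 := by simpa using hj
  have hmin' : ∀ i < m, f.coeff i ≠ 0 → v j * (m - i) ≤ v i * (m - j) := by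
    intro i hi hi0
    have h := hmin i (by simp [hi, hi0])
    have h1 : (0 : ℚ) < (m : ℚ) - i := by rw [sub_pos]; exact_mod_cast hi
    have h2 : (0 : ℚ) < (m : ℚ) - j := by rw [sub_pos]; exact_mod_cast hjm
    rw [div_le_div_iff₀ h2 h1] at h
    have : ((v j * (m - i) : ℕ) : ℚ) ≤ ((v i * (m - j) : ℕ) : ℚ) := by
      rw [Nat.cast_mul, Nat.cast_mul, Nat.cast_sub hi.le, Nat.cast_sub hjm.le]
      exact h
    exact_mod_cast this
  have hq : m - j ≠ 0 := by omega
  have hvj : 0 < v j := by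
    obtain ⟨u, hu, hu0⟩ := hv j hj0
    rcases Nat.eq_zero_or_pos (v j) with h | h
    · rw [h, pow_zero, one_mul] at hu
      exact absurd (hu ▸ hlt j hjm) hu0
    · exact h
  have hcoeff : ∀ i, ((f.map (PowerSeries.expand (m - j) hq).toRingHom).comp
      (C (PowerSeries.X ^ v j) * X)).coeff i =
      PowerSeries.expand (m - j) hq (f.coeff i) * PowerSeries.X ^ (v j * i) := by
    intro i
    rw [comp_C_mul_X_coeff, coeff_map, pow_mul]
    rfl
  have hexp : ∀ i, f.coeff i ≠ 0 → ∃ u, PowerSeries.constantCoeff u ≠ 0 ∧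
      PowerSeries.expand (m - j) hq (f.coeff i) * PowerSeries.X ^ (v j * i) =
      PowerSeries.X ^ (v i * (m - j) + v j * i) * u := by
    intro i hi
    obtain ⟨u, hu, hu0⟩ := hv i hi
    refine ⟨PowerSeries.expand (m - j) hq u, by simpa using hu0, ?_⟩
    rw [hu, map_mul, map_pow, PowerSeries.expand_X]
    ring
  have hdvd : C (PowerSeries.X ^ (v j * m)) ∣
      (f.map (PowerSeries.expand (m - j) hq).toRingHom).comp (C (PowerSeries.X ^ v j) * X) := by
    rw [C_dvd_iff_dvd_coeff]
    intro i
    rw [hcoeff]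
    by_cases hi0 : f.coeff i = 0
    · simp [hi0]
    rcases lt_or_ge i m with hi | hi
    · obtain ⟨u, -, hu⟩ := hexp i hi0
      rw [hu]
      refine Dvd.dvd.mul_right (pow_dvd_pow _ ?_) _
      have := hmin' i hi hi0
      obtain ⟨k, rfl⟩ := Nat.exists_eq_add_of_lt hi
      have e : i + k + 1 - i = k + 1 := by omega
      rw [e] at this
      nlinarith
    · exact Dvd.dvd.mul_left (pow_dvd_pow _ (Nat.mul_le_mul_left _ hi)) _
  obtain ⟨g, hg⟩ := hdvd
  have hgc : ∀ i, PowerSeries.expand (m - j) hq (f.coeff i) * PowerSeries.X ^ (v j * i) =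
      PowerSeries.X ^ (v j * m) * g.coeff i := by
    intro i
    rw [← hcoeff, hg, coeff_C_mul]
  have hX : (PowerSeries.X ^ (v j * m) : PowerSeries ℂ) ≠ 0 := pow_ne_zero _ PowerSeries.X_ne_zero
  refine ⟨m - j, hq, v j, g, hg, ?_, ?_, ?_, j, hjm, ?_⟩
  · have := hgc m
    rw [mul_comm, mul_right_inj' hX] at this
    rw [← this]
    simpa using hm
  · intro i hi
    obtain ⟨k, rfl⟩ := Nat.exists_eq_add_of_lt hi
    have := hgc (m + k + 1)
    rw [show v j * (m + k + 1) = v j * m + v j * (k + 1) by ring, pow_add, mul_left_comm,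
      mul_right_inj' hX] at this
    rw [← this, map_mul, map_pow, PowerSeries.constantCoeff_X, zero_pow (by positivity), mul_zero]
  · have := hgc (m - 1)
    rw [hpred, map_zero, zero_mul] at this
    exact (mul_eq_zero.1 this.symm).resolve_left hX
  · obtain ⟨u, hu0, hu⟩ := hexp j hj0
    have := hgc j
    rw [hu, show v j * (m - j) + v j * j = v j * m by
      rw [← mul_add, Nat.sub_add_cancel hjm.le], mul_right_inj' hX] at this
    rwa [← this]

theorem exists_root_taylor_coeff_ne_zero {m : ℕ} (G : ℂ[X]) (hG : G.natDegree = m)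
    (hm0 : 0 < m) (hpred : G.coeff (m - 1) = 0) (hi : ∃ i < m, G.coeff i ≠ 0) :
    ∃ (c : ℂ) (k : ℕ), 0 < k ∧ k < m ∧ (∀ i < k, (taylor c G).coeff i = 0) ∧
      (taylor c G).coeff k ≠ 0 := by
  obtain ⟨i, him, hi⟩ := hi
  have hG0 : G ≠ 0 := by rintro rfl; simp at hi
  obtain ⟨c, hc⟩ := IsAlgClosed.exists_root G (by
    rw [degree_eq_natDegree hG0, hG]; exact_mod_cast hm0.ne')
  have hT0 : taylor c G ≠ 0 := by rwa [Ne, taylor_eq_zero]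
  refine ⟨c, (taylor c G).natTrailingDegree, ?_, ?_, ?_, ?_⟩
  · rw [Nat.pos_iff_ne_zero]
    intro h
    have := mt (coeff_natTrailingDegree_eq_zero (p := taylor c G)).1 hT0
    rw [h, taylor_coeff_zero] at this
    exact this hc
  · have hle := natTrailingDegree_le_natDegree (taylor c G)
    rw [natDegree_taylor, hG] at hle
    refine lt_of_le_of_ne hle fun h => ?_
    have hlow : ∀ l < m, (taylor c G).coeff l = 0 := fun l hl =>
      coeff_eq_zero_of_lt_natTrailingDegree (h ▸ hl)
    have hc0 : c = 0 := by
      have h1 := hlow (m - 1) (by omega)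
      rw [taylor_coeff, eval_eq_sum_range' (n := 2)
        (by have := natDegree_hasseDeriv_le G (m - 1); omega)] at h1
      have e : 1 + (m - 1) = m := by omega
      simp only [Finset.sum_range_succ, Finset.sum_range_zero, hasseDeriv_coeff, zero_add, hpred,
        mul_zero, e, zero_mul, pow_one] at h1
      have hlead : G.coeff m ≠ 0 := by rw [← hG]; exact leadingCoeff_ne_zero.2 hG0
      have hch : ((m.choose (m - 1) : ℕ) : ℂ) ≠ 0 := by
        exact_mod_cast (Nat.choose_pos (Nat.sub_le m 1)).ne'
      exact (mul_eq_zero.1 h1).resolve_left (mul_ne_zero hch hlead)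
    have := hlow i him
    rw [hc0, taylor_zero] at this
    exact hi this
  · intro l hl
    exact coeff_eq_zero_of_lt_natTrailingDegree hl
  · exact mt coeff_natTrailingDegree_eq_zero.1 hT0

/-- A polynomial over `ℂ⟦t⟧` whose reduction has a zero of finite positive order at the origin
acquires a root after a ramification. -/
theorem powerSeries_exists_expand_root (m : ℕ) (hm0 : 0 < m) (f : (PowerSeries ℂ)[X])
    (hlt : ∀ i < m, PowerSeries.constantCoeff (f.coeff i) = 0)
    (hm : PowerSeries.constantCoeff (f.coeff m) ≠ 0) :
    ∃ (q : ℕ) (hq : q ≠ 0) (x : PowerSeries ℂ),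
      f.eval₂ (PowerSeries.expand q hq).toRingHom x = 0 := by
  induction m using Nat.strong_induction_on generalizing f with
  | _ m ih =>
    obtain ⟨c, hc, hc'⟩ := powerSeries_exists_root_of_coeff (hasseDeriv (m - 1) f)
      (by simpa [hasseDeriv_coeff] using hlt (m - 1) (by omega))
      (by
        have e : 1 + (m - 1) = m := by omega
        rw [hasseDeriv_coeff, e, map_mul, map_natCast]
        exact mul_ne_zero (by exact_mod_cast (Nat.choose_pos (Nat.sub_le m 1)).ne') hm)
    suffices ∃ (q : ℕ) (hq : q ≠ 0) (x : PowerSeries ℂ),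
        (taylor c f).eval₂ (PowerSeries.expand q hq).toRingHom x = 0 by
      obtain ⟨q, hq, x, hx⟩ := this
      refine ⟨q, hq, x + PowerSeries.expand q hq c, ?_⟩
      rw [taylor_apply, eval₂_comp, eval₂_add, eval₂_X, eval₂_C] at hx
      exact hx
    have hred : ∀ i, PowerSeries.constantCoeff ((taylor c f).coeff i) =
        PowerSeries.constantCoeff (f.coeff i) := by
      intro i
      rw [← coeff_map, map_taylor, hc, taylor_zero, coeff_map]
    by_cases h0 : (taylor c f).coeff 0 = 0
    · refine ⟨1, one_ne_zero, 0, ?_⟩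
      rw [eval₂_at_zero, h0, map_zero]
    obtain ⟨q, hq, w, g, hg, hgm, hgt, hgp, hgi⟩ := powerSeries_exists_newton_step (taylor c f)
      (fun i hi => by rw [hred]; exact hlt i hi) (by rwa [hred])
      (by rw [taylor_coeff]; exact hc') h0 hm0
    obtain ⟨b, k, hk0, hkm, hklt, hk⟩ := exists_root_taylor_coeff_ne_zero (m := m)
      (g.map PowerSeries.constantCoeff)
      (natDegree_eq_of_le_of_coeff_ne_zero
        (natDegree_le_iff_coeff_eq_zero.2 fun i hi => by rw [coeff_map]; exact hgt i hi)
        (by rwa [coeff_map])) hm0 (by rw [coeff_map, hgp, map_zero])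
      (by simpa only [coeff_map] using hgi)
    have hred' : ∀ i, PowerSeries.constantCoeff ((taylor (PowerSeries.C b) g).coeff i) =
        (taylor b (g.map PowerSeries.constantCoeff)).coeff i := by
      intro i
      rw [← coeff_map, map_taylor, PowerSeries.constantCoeff_C]
    obtain ⟨q', hq', y, hy⟩ := ih k hkm hk0 (taylor (PowerSeries.C b) g)
      (fun i hi => by rw [hred']; exact hklt i hi) (by rwa [hred'])
    rw [taylor_apply, eval₂_comp, eval₂_add, eval₂_X, eval₂_C] at hy
    refine ⟨q' * q, mul_ne_zero hq' hq, (PowerSeries.expand q' hq').toRingHom (PowerSeries.X ^ w) *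
      (y + (PowerSeries.expand q' hq').toRingHom (PowerSeries.C b)), ?_⟩
    have h2 := congrArg (eval₂ (PowerSeries.expand q' hq').toRingHom
      (y + (PowerSeries.expand q' hq').toRingHom (PowerSeries.C b))) hg
    rw [eval₂_mul, hy, mul_zero, eval₂_comp, eval₂_mul, eval₂_X, eval₂_C, eval₂_map] at h2
    rw [← h2, PowerSeries.expand_mul_eq_comp _ _ _ hq]
    rfl

end NewtonPuiseux

section Ramification

open Polynomial

theorem ramify_coeff_mul (q : ℕ) (hq : 0 < q) (x : LaurentSeries ℂ) (n : ℤ) :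
    (ramify q hq x).coeff (q * n) = x.coeff n :=
  HahnSeries.embDomain_coeff

theorem ramify_coeff_of_not_dvd (q : ℕ) (hq : 0 < q) (x : LaurentSeries ℂ) (n : ℤ)
    (hn : ¬ (q : ℤ) ∣ n) : (ramify q hq x).coeff n = 0 :=
  HahnSeries.embDomain_of_notMem_range (by rintro ⟨m, rfl⟩; exact hn ⟨m, rfl⟩)

theorem ramify_ofPowerSeries (q : ℕ) (hq : 0 < q) (x : PowerSeries ℂ) :
    ramify q hq (HahnSeries.ofPowerSeries ℤ ℂ x) =
      HahnSeries.ofPowerSeries ℤ ℂ (PowerSeries.expand q hq.ne' x) := by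
  ext n
  have hq' : (0 : ℤ) < q := by exact_mod_cast hq
  rw [PowerSeries.coeff_coe]
  by_cases hn : (q : ℤ) ∣ n
  · obtain ⟨m, rfl⟩ := hn
    rw [ramify_coeff_mul, PowerSeries.coeff_coe, Int.natAbs_mul, Int.natAbs_natCast,
      PowerSeries.coeff_expand_mul]
    simp only [mul_neg_iff, hq', hq'.le.not_gt, true_and, false_and, or_false]
  · rw [ramify_coeff_of_not_dvd q hq x n hn, PowerSeries.coeff_expand_of_not_dvd, ite_self]
    rwa [← Int.natCast_dvd]

theorem ramify_ramify (q q' : ℕ) (hq : 0 < q) (hq' : 0 < q') :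
    (ramify q' hq').comp (ramify q hq) = ramify (q' * q) (Nat.mul_pos hq' hq) := by
  ext x n
  rw [RingHom.comp_apply]
  by_cases hn : (q' : ℤ) ∣ n
  · obtain ⟨m, rfl⟩ := hn
    rw [ramify_coeff_mul]
    by_cases hm : (q : ℤ) ∣ m
    · obtain ⟨k, rfl⟩ := hm
      rw [ramify_coeff_mul, ← mul_assoc, ← Nat.cast_mul, ramify_coeff_mul]
    · rw [ramify_coeff_of_not_dvd q hq x m hm, ramify_coeff_of_not_dvd]
      rwa [Nat.cast_mul, mul_dvd_mul_iff_left (by exact_mod_cast hq'.ne')]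
  · rw [ramify_coeff_of_not_dvd q' hq' _ n hn, ramify_coeff_of_not_dvd]
    rw [Nat.cast_mul]
    exact fun h => hn (dvd_of_mul_right_dvd h)

theorem exists_ramify_root (f : (LaurentSeries ℂ)[X]) (hf : f.Monic) (hn : 0 < f.natDegree) :
    ∃ (q : ℕ) (hq : 0 < q) (x : LaurentSeries ℂ), (f.map (ramify q hq)).IsRoot x := by
  obtain ⟨⟨-, N, rfl⟩, hN⟩ := IsLocalization.exist_integer_multiples
    (Submonoid.powers (PowerSeries.X : PowerSeries ℂ)) (Finset.range f.natDegree) f.coeff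
  set t : LaurentSeries ℂ := HahnSeries.ofPowerSeries ℤ ℂ PowerSeries.X with ht
  have ht0 : t ≠ 0 := by
    rw [ht, Ne, map_eq_zero_iff _ HahnSeries.ofPowerSeries_injective]
    exact PowerSeries.X_ne_zero
  have hcoeff : ∀ i < f.natDegree, ∃ y, HahnSeries.ofPowerSeries ℤ ℂ (PowerSeries.X * y) =
      (f.scaleRoots (t ^ (N + 1))).coeff i := by
    intro i hi
    obtain ⟨y, hy⟩ := hN i (Finset.mem_range.2 hi)
    obtain ⟨k, hk⟩ := Nat.exists_eq_add_of_lt hi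
    refine ⟨y * (PowerSeries.X ^ ((N + 1) * k)), ?_⟩
    have hy' : HahnSeries.ofPowerSeries ℤ ℂ y = t ^ N * f.coeff i := by
      rw [ht, ← map_pow]
      exact hy.trans (Algebra.smul_def _ _)
    rw [coeff_scaleRoots, map_mul, map_mul, hy', map_pow, ← ht,
      show f.natDegree - i = k + 1 by omega]
    ring
  obtain ⟨g, hg⟩ : f.scaleRoots (t ^ (N + 1)) ∈ lifts (HahnSeries.ofPowerSeries ℤ ℂ) := by
    rw [lifts_iff_coeff_lifts]
    intro i
    rcases lt_trichotomy i f.natDegree with hi | rfl | hi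
    · obtain ⟨y, hy⟩ := hcoeff i hi
      exact ⟨_, hy⟩
    · exact ⟨1, by rw [coeff_scaleRoots_natDegree, hf.leadingCoeff, map_one]⟩
    · refine ⟨0, ?_⟩
      rw [coeff_eq_zero_of_natDegree_lt (by rwa [natDegree_scaleRoots]), map_zero]
  have hgc : ∀ i, HahnSeries.ofPowerSeries ℤ ℂ (g.coeff i) =
      (f.scaleRoots (t ^ (N + 1))).coeff i := by
    intro i
    rw [← hg, coe_mapRingHom, coeff_map]
  obtain ⟨q, hq, x, hx⟩ := powerSeries_exists_expand_root f.natDegree hn g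
    (by
      intro i hi
      obtain ⟨y, hy⟩ := hcoeff i hi
      rw [HahnSeries.ofPowerSeries_injective ((hgc i).trans hy.symm), map_mul,
        PowerSeries.constantCoeff_X, zero_mul])
    (by
      have h1 := hgc f.natDegree
      rw [coeff_scaleRoots_natDegree, hf.leadingCoeff,
        ← map_one (HahnSeries.ofPowerSeries ℤ ℂ)] at h1
      rw [HahnSeries.ofPowerSeries_injective h1, map_one]
      exact one_ne_zero)
  have hq' : 0 < q := Nat.pos_of_ne_zero hq
  have hs0 : ramify q hq' (t ^ (N + 1)) ≠ 0 := by
    rw [_root_.map_ne_zero]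
    exact pow_ne_zero _ ht0
  refine ⟨q, hq', HahnSeries.ofPowerSeries ℤ ℂ x / ramify q hq' (t ^ (N + 1)), ?_⟩
  have h2 := congrArg (HahnSeries.ofPowerSeries ℤ ℂ) hx
  rw [hom_eval₂, map_zero, show (HahnSeries.ofPowerSeries ℤ ℂ).comp
      (PowerSeries.expand q hq).toRingHom = (ramify q hq').comp (HahnSeries.ofPowerSeries ℤ ℂ) from
      RingHom.ext fun y => (ramify_ofPowerSeries q hq' y).symm, ← eval₂_map,
      ← coe_mapRingHom, hg] at h2
  have h3 := scaleRoots_eval₂_mul (p := f) (ramify q hq')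
    (HahnSeries.ofPowerSeries ℤ ℂ x / ramify q hq' (t ^ (N + 1))) (t ^ (N + 1))
  rw [mul_div_cancel₀ _ hs0, h2] at h3
  rw [IsRoot, eval_map]
  exact (mul_eq_zero.1 h3.symm).resolve_left (pow_ne_zero _ hs0)

/-- The Newton–Puiseux theorem: a monic polynomial over `ℂ((t))` splits after a ramification. -/
theorem exists_ramify_splits (f : (LaurentSeries ℂ)[X]) (hf : f.Monic) :
    ∃ (q : ℕ) (hq : 0 < q), (f.map (ramify q hq)).Splits := by
  induction h : f.natDegree using Nat.strong_induction_on generalizing f with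
  | _ n ih =>
    rcases Nat.eq_zero_or_pos n with rfl | hn
    · exact ⟨1, one_pos, Splits.of_natDegree_eq_zero (by rw [hf.natDegree_map, h])⟩
    obtain ⟨q, hq, x, hx⟩ := exists_ramify_root f hf (h ▸ hn)
    obtain ⟨g, hg⟩ := dvd_iff_isRoot.2 hx
    have hfm : (f.map (ramify q hq)).Monic := hf.map _
    have hgm : g.Monic := (monic_X_sub_C x).of_mul_monic_left (hg ▸ hfm)
    have hdeg : g.natDegree < n := by
      have := congrArg natDegree hg
      rw [hf.natDegree_map, (monic_X_sub_C x).natDegree_mul hgm, natDegree_X_sub_C, h] at this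
      omega
    obtain ⟨q', hq', hs⟩ := ih g.natDegree hdeg g hgm rfl
    refine ⟨q' * q, Nat.mul_pos hq' hq, ?_⟩
    rw [← ramify_ramify q q' hq hq', ← Polynomial.map_map, hg, Polynomial.map_mul]
    exact ((Splits.X_sub_C x).map _).mul hs

end Ramification

section Jordan

universe u v

open Polynomial DirectSum

theorem exists_basis_quotient_X_sub_C_pow {K : Type*} [Field K] (a : K) (e : ℕ) (J : Ideal K[X])
    (hJ : J = Ideal.span {(X - C a) ^ e}) :
    ∃ b : Module.Basis (Fin e) K (K[X] ⧸ J), ∀ k : Fin e, (X : K[X]) • b k =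
      a • b k + if h : (k : ℕ) + 1 < e then b ⟨k + 1, h⟩ else 0 := by
  have hJ' : J = (Ideal.span {(X : K[X]) ^ e}).map (taylorEquiv (-a) : K[X] →+* K[X]) := by
    rw [hJ, Ideal.map_span, Set.image_singleton, map_pow]
    congr 3
    change X - C a = taylor (-a) X
    rw [taylor_X, C_neg, sub_eq_add_neg]
  let T := Ideal.quotientEquivAlg (Ideal.span {(X : K[X]) ^ e}) J (taylorEquiv (-a)) hJ'
  let P := AdjoinRoot.powerBasis' (monic_X_pow (R := K) e)
  let b := (P.basis.reindex (finCongr (natDegree_X_pow e : P.dim = e))).map T.toLinearEquiv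
  have hb : ∀ k, b k = Ideal.Quotient.mk J ((X - C a) ^ (k : ℕ)) := by
    intro k
    have h1 : (P.basis.reindex (finCongr (natDegree_X_pow e : P.dim = e))) k =
        Ideal.Quotient.mk (Ideal.span {(X : K[X]) ^ e}) (X ^ (k : ℕ)) := by
      rw [Module.Basis.reindex_apply, PowerBasis.basis_eq_pow, map_pow]
      rfl
    rw [show b k = T ((P.basis.reindex (finCongr (natDegree_X_pow e : P.dim = e))) k) from
      Module.Basis.map_apply _ _ _, h1]
    change Ideal.Quotient.mk J (taylor (-a) (X ^ (k : ℕ))) = _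
    rw [taylor_X_pow, C_neg, ← sub_eq_add_neg]
  refine ⟨b, fun k => ?_⟩
  have h2 : (X : K[X]) • b k = a • b k + Ideal.Quotient.mk J ((X - C a) ^ ((k : ℕ) + 1)) := by
    rw [hb]
    change Ideal.Quotient.mk J (X * (X - C a) ^ (k : ℕ)) =
      Ideal.Quotient.mk J (a • (X - C a) ^ (k : ℕ)) + _
    rw [← map_add, smul_eq_C_mul]
    congr 1
    ring
  rw [h2]
  split_ifs with h
  · rw [hb ⟨k + 1, h⟩]
  · have hk : (k : ℕ) + 1 = e := by have := k.2; omega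
    rw [hk, Ideal.Quotient.eq_zero_iff_mem.2 (hJ ▸ Ideal.mem_span_singleton_self _)]

/-- Jordan normal form: an endomorphism annihilated by a nonzero split polynomial has a basis
consisting of Jordan chains. -/
theorem exists_jordan_basis {K : Type u} {V : Type v} [Field K] [AddCommGroup V] [Module K V]
    [FiniteDimensional K V] (f : Module.End K V) (p : K[X]) (hp0 : p ≠ 0) (hp : p.Splits)
    (hf : aeval f p = 0) :
    ∃ (ι : Type u) (_ : Fintype ι) (a : ι → K) (e : ι → ℕ)
      (b : Module.Basis (Σ i, Fin (e i)) K V), ∀ i (k : Fin (e i)), f (b ⟨i, k⟩) =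
        a i • b ⟨i, k⟩ + if h : (k : ℕ) + 1 < e i then b ⟨i, ⟨k + 1, h⟩⟩ else 0 := by
  classical
  obtain ⟨ι, hι, ϖ, hϖ, e, ⟨Φ⟩⟩ := Module.equiv_directSum_of_isTorsion
    (Module.AEval.isTorsion_of_finiteDimensional K V f)
  have hdvd : ∀ i, ϖ i ^ e i ∣ p := by
    intro i
    have hx : ∀ x : ⨁ i, K[X] ⧸ K[X] ∙ ϖ i ^ e i, p • x = 0 := by
      intro x
      obtain ⟨m, rfl⟩ := Φ.surjective x
      obtain ⟨v, rfl⟩ := (Module.AEval'.of f).surjective m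
      rw [← map_smul, Module.AEval'.of, ← Module.AEval.of_aeval_smul, hf, zero_smul, map_zero,
        map_zero]
    have h1 := hx (DFinsupp.single i (Submodule.Quotient.mk 1))
    have h2 : Submodule.Quotient.mk (p := K[X] ∙ ϖ i ^ e i) (p • (1 : K[X])) = 0 := by
      have h3 : DFinsupp.single i (p • Submodule.Quotient.mk (p := K[X] ∙ ϖ i ^ e i) (1 : K[X])) =
          (0 : Π₀ i, K[X] ⧸ K[X] ∙ ϖ i ^ e i) := by
        rw [DFinsupp.single_smul]
        exact h1
      rw [Submodule.Quotient.mk_smul]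
      exact (DFinsupp.single_eq_zero (β := fun i => K[X] ⧸ K[X] ∙ ϖ i ^ e i)).1 h3
    rw [Submodule.Quotient.mk_eq_zero, smul_eq_mul, mul_one] at h2
    exact Ideal.mem_span_singleton.1 h2
  have hb : ∀ i, ∃ (a : K) (b : Module.Basis (Fin (e i)) K (K[X] ⧸ K[X] ∙ ϖ i ^ e i)),
      ∀ k : Fin (e i), (X : K[X]) • b k =
        a • b k + if h : (k : ℕ) + 1 < e i then b ⟨k + 1, h⟩ else 0 := by
    intro i
    suffices ∃ a : K, Associated (ϖ i ^ e i) ((X - C a) ^ e i) by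
      obtain ⟨a, ha⟩ := this
      exact ⟨a, exists_basis_quotient_X_sub_C_pow a (e i) _
        (Ideal.span_singleton_eq_span_singleton.2 ha)⟩
    rcases Nat.eq_zero_or_pos (e i) with h | h
    · exact ⟨0, by rw [h, pow_zero, pow_zero]⟩
    have hs : (ϖ i).Splits := hp.of_dvd hp0 ((dvd_pow_self _ h.ne').trans (hdvd i))
    obtain ⟨a, ha⟩ := hs.exists_eval_eq_zero (degree_pos_of_irreducible (hϖ i)).ne'
    exact ⟨a, ((irreducible_X_sub_C a).associated_of_dvd (hϖ i)
      (dvd_iff_isRoot.2 ha)).symm.pow_pow⟩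
  choose a b hb using hb
  let Ψ : V ≃ₗ[K] Π₀ i, K[X] ⧸ K[X] ∙ ϖ i ^ e i :=
    (Module.AEval'.of f).trans (Φ.restrictScalars K)
  refine ⟨ι, hι, a, e, (DFinsupp.basis b).map Ψ.symm, fun i k => ?_⟩
  have hB : ∀ k, (DFinsupp.basis b) ⟨i, k⟩ = DFinsupp.single i (b i k) := by
    intro k
    refine Module.Basis.apply_eq_iff.2 (Finsupp.ext fun ⟨j, y⟩ => ?_)
    change (b j).repr (DFinsupp.single (β := fun i => K[X] ⧸ K[X] ∙ ϖ i ^ e i) i (b i k) j) y = _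
    by_cases h : i = j
    · subst h
      simp [Finsupp.single_apply_left sigma_mk_injective]
    · have h' : (⟨i, k⟩ : Σ i, Fin (e i)) ≠ ⟨j, y⟩ := fun hh => h (congrArg Sigma.fst hh)
      rw [DFinsupp.single_eq_of_ne (Ne.symm h), map_zero, Finsupp.single_eq_of_ne h'.symm]
      rfl
  have hX : ∀ y : Π₀ i, K[X] ⧸ K[X] ∙ ϖ i ^ e i, f (Ψ.symm y) = Ψ.symm ((X : K[X]) • y) := by
    intro y
    change f ((Module.AEval'.of f).symm (Φ.symm y)) = (Module.AEval'.of f).symm (Φ.symm (X • y))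
    rw [map_smul, Module.AEval'.of_symm_X_smul]
  rw [Module.Basis.map_apply, hX, hB, ← DFinsupp.single_smul, hb, DFinsupp.single_add, map_add]
  congr 1
  · rw [DFinsupp.single_smul, map_smul]
  · split_ifs with h
    · rw [Module.Basis.map_apply, hB]
    · rw [DFinsupp.single_zero, map_zero]

end Jordan

section BlockDecomposition

open Polynomial

/-- Every Laurent series is `s·φ′(s)` for some `φ ∈ s⁻¹ℂ[s⁻¹]` up to a power series. -/
theorem exists_eq_sPhiDeriv_add (x : LaurentSeries ℂ) :
    ∃ p : ℂ[X], p.coeff 0 = 0 ∧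
      ∃ B : PowerSeries ℂ, x = sPhiDeriv p + HahnSeries.ofPowerSeries ℤ ℂ B := by
  obtain ⟨N, hN⟩ : ∃ N : ℕ, ∀ n : ℤ, n < -N → x.coeff n = 0 := by
    refine ⟨x.order.natAbs, fun n hn => HahnSeries.coeff_eq_zero_of_lt_order ?_⟩
    omega
  let p : ℂ[X] := ∑ k ∈ Finset.Icc 1 N, monomial k (-x.coeff (-(k : ℤ)) / k)
  have hp : ∀ k : ℕ, p.coeff k = -x.coeff (-(k : ℤ)) / k := by
    intro k
    simp only [p, finsetSum_coeff, coeff_monomial, Finset.sum_ite_eq', Finset.mem_Icc]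
    split_ifs with h
    · rfl
    · rcases Nat.eq_zero_or_pos k with rfl | hk
      · simp
      · rw [hN _ (by omega), neg_zero, zero_div]
  refine ⟨p, by simp [hp], PowerSeries.mk fun n => x.coeff n, ?_⟩
  have hs : ∀ n : ℤ, (sPhiDeriv p).coeff n = if n < 0 then x.coeff n else 0 := by
    intro n
    rw [sPhiDeriv, HahnSeries.coeff_sum]
    simp only [HahnSeries.coeff_single]
    split_ifs with h
    · obtain ⟨m, rfl⟩ : ∃ m : ℕ, n = -m := ⟨n.natAbs, by omega⟩
      have hm : (m : ℂ) ≠ 0 := by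
        have : m ≠ 0 := by omega
        exact_mod_cast this
      simp only [neg_inj, Nat.cast_inj, Finset.sum_ite_eq, mem_support_iff]
      split_ifs with h'
      · rw [hp]
        field_simp
      · rw [not_not, hp, div_eq_zero_iff, neg_eq_zero] at h'
        exact (h'.resolve_right hm).symm
    · refine Finset.sum_eq_zero fun k _ => ?_
      split_ifs with h'
      · have : k = 0 := by omega
        simp [this]
      · rfl
  ext n
  rw [HahnSeries.coeff_add, hs]
  rcases lt_or_ge n 0 with h | h
  · rw [if_pos h, HahnSeries.ofPowerSeries_apply, HahnSeries.embDomain_of_notMem_range, add_zero]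
    rintro ⟨m, hm⟩
    simp at hm
    omega
  · obtain ⟨m, rfl⟩ := Int.eq_ofNat_of_zero_le h
    rw [if_neg (by omega), zero_add]
    erw [HahnSeries.ofPowerSeries_apply_coeff]
    rw [PowerSeries.coeff_mk]

/-- A matrix whose diagonal has polar parts `s·φₓ′(s)` and whose other entries are power series
vanishing between indices with different `φₓ` becomes block diagonal after grouping equal `φₓ`. -/
theorem exists_eq_submatrix_blockDiagonal' {X : Type*} [Fintype X] [DecidableEq X]
    (c : X → ℂ[X]) (M : Matrix X X (LaurentSeries ℂ))
    (hM : ∀ x y, ∃ n : PowerSeries ℂ, (c x ≠ c y → n = 0) ∧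
      M x y = (if x = y then sPhiDeriv (c x) else 0) + HahnSeries.ofPowerSeries ℤ ℂ n) :
    ∃ (r : ℕ) (dims : Fin r → ℕ) (p : Fin r → ℂ[X]),
      (∀ j, ∃ x, p j = c x) ∧ Function.Injective p ∧
      ∃ (B : ∀ j, Matrix (Fin (dims j)) (Fin (dims j)) (PowerSeries ℂ))
        (e : X ≃ (Σ j, Fin (dims j))),
        M = (Matrix.blockDiagonal' (fun j => sPhiDeriv (p j) •
            (1 : Matrix (Fin (dims j)) (Fin (dims j)) (LaurentSeries ℂ)) +
              (B j).map (HahnSeries.ofPowerSeries ℤ ℂ))).submatrix e e := by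
  classical
  choose N hN0 hN using hM
  let E := (Finset.univ.image c).equivFin
  let p : Fin (Finset.univ.image c).card → ℂ[X] := fun j => (E.symm j).1
  have hp : Function.Injective p := Subtype.val_injective.comp E.symm.injective
  let g : X → Fin (Finset.univ.image c).card :=
    fun x => E ⟨c x, Finset.mem_image_of_mem c (Finset.mem_univ x)⟩
  have hpg : ∀ x, p (g x) = c x := fun x => by simp [p, g]
  let F := fun j => Fintype.equivFin {x // g x = j}
  let e : X ≃ Σ j, Fin (Fintype.card {x // g x = j}) :=
    (Equiv.sigmaFiberEquiv g).symm.trans (Equiv.sigmaCongrRight F)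
  have he : ∀ j k, e.symm ⟨j, k⟩ = ((F j).symm k).1 := fun j k => rfl
  have hc : ∀ j k, c (e.symm ⟨j, k⟩) = p j := fun j k => by
    rw [he, ← hpg, ((F j).symm k).2]
  refine ⟨_, _, p, fun j => ?_, hp, 
    fun j => Matrix.of fun k l => N (e.symm ⟨j, k⟩) (e.symm ⟨j, l⟩), e, ?_⟩
  · obtain ⟨x, -, hx⟩ := Finset.mem_image.1 (E.symm j).2
    exact ⟨x, hx.symm⟩
  suffices h : ∀ u v, M (e.symm u) (e.symm v) = Matrix.blockDiagonal' (fun j => sPhiDeriv (p j) •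
      (1 : Matrix (Fin (Fintype.card {x // g x = j})) (Fin (Fintype.card {x // g x = j}))
        (LaurentSeries ℂ)) + Matrix.map (Matrix.of fun k l => N (e.symm ⟨j, k⟩) (e.symm ⟨j, l⟩))
          (HahnSeries.ofPowerSeries ℤ ℂ)) u v by
    ext1 x y
    have := h (e x) (e y)
    rwa [e.symm_apply_apply, e.symm_apply_apply] at this
  rintro ⟨j, k⟩ ⟨j', l⟩
  rw [hN, hc]
  by_cases hj : j = j'
  · subst hj
    rw [Matrix.blockDiagonal'_apply_eq, Matrix.add_apply, Matrix.smul_apply, Matrix.map_apply,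
      Matrix.of_apply, Matrix.one_apply, smul_eq_mul, mul_ite, mul_one, mul_zero]
    congr 1
    simp [e.symm.injective.eq_iff]
  · rw [Matrix.blockDiagonal'_apply_ne _ _ _ hj, hN0 _ _ (by rw [hc, hc]; exact hp.ne hj),
      map_zero, add_zero, if_neg]
    intro h
    exact hj (congrArg Sigma.fst (e.symm.injective h))

end BlockDecomposition

theorem higgs_matrix_exponential_regular_decomposition
    (d : ℕ) (hd : 1 ≤ d) (A : Matrix (Fin d) (Fin d) (LaurentSeries ℂ)) :
    ∃ (q : ℕ) (hq : 0 < q) (P : Matrix (Fin d) (Fin d) (LaurentSeries ℂ)),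
      IsUnit P ∧
      ∃ (r : ℕ) (dims : Fin r → ℕ) (p : Fin r → Polynomial ℂ),
        (∀ j, (p j).coeff 0 = 0) ∧ Function.Injective p ∧
        ∃ (B : ∀ j, Matrix (Fin (dims j)) (Fin (dims j)) (PowerSeries ℂ))
          (e : Fin d ≃ (Σ j, Fin (dims j))),
          A.map (ramify q hq) * P =
            P * (Matrix.blockDiagonal'
              (fun j => sPhiDeriv (p j) •
                  (1 : Matrix (Fin (dims j)) (Fin (dims j)) (LaurentSeries ℂ)) +
                (B j).map (HahnSeries.ofPowerSeries ℤ ℂ))).submatrix e e := by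
  classical
  obtain ⟨q, hq, hs⟩ := exists_ramify_splits A.charpoly A.charpoly_monic
  rw [← Matrix.charpoly_map] at hs
  have hCH : Polynomial.aeval (Matrix.toLin' (A.map (ramify q hq)))
      (A.map (ramify q hq)).charpoly = 0 := by
    rw [← Matrix.charpoly_toLin', LinearMap.aeval_self_charpoly]
  obtain ⟨ι, _, a, m, b, hb⟩ := exists_jordan_basis (Matrix.toLin' (A.map (ramify q hq)))
    _ (Matrix.charpoly_monic _).ne_zero hs hCH
  choose φ hφ R hR using fun i => exists_eq_sPhiDeriv_add (a i)
  let ε : (Σ i, Fin (m i)) ≃ Fin d := b.indexEquiv (Pi.basisFun (LaurentSeries ℂ) (Fin d))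
  have hM : ∀ x y, ∃ n : PowerSeries ℂ, (φ x.1 ≠ φ y.1 → n = 0) ∧
      LinearMap.toMatrix b b (Matrix.toLin' (A.map (ramify q hq))) x y =
        (if x = y then sPhiDeriv (φ x.1) else 0) + HahnSeries.ofPowerSeries ℤ ℂ n := by
    rintro x ⟨i, k⟩
    have hn : ∃ n : PowerSeries ℂ, (φ x.1 ≠ φ i → n = 0) ∧
        b.repr (if h : (k : ℕ) + 1 < m i then b ⟨i, ⟨k + 1, h⟩⟩ else 0) x =
          HahnSeries.ofPowerSeries ℤ ℂ n := by
      split_ifs with h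
      · by_cases hx : (⟨i, ⟨k + 1, h⟩⟩ : Σ i, Fin (m i)) = x
        · subst hx
          exact ⟨1, fun h' => absurd rfl h', by simp⟩
        · exact ⟨0, fun _ => rfl, by simp [hx]⟩
      · exact ⟨0, fun _ => rfl, by simp⟩
    obtain ⟨n, hn0, hn⟩ := hn
    rw [LinearMap.toMatrix_apply, hb, map_add, Finsupp.add_apply, hn, map_smul,
      Finsupp.smul_apply, b.repr_self_apply, smul_eq_mul]
    by_cases hx : x = ⟨i, k⟩
    · subst hx
      refine ⟨R i + n, fun h => absurd rfl h, ?_⟩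
      rw [if_pos rfl, if_pos rfl, mul_one, map_add, hR i, add_assoc]
    · exact ⟨n, hn0, by rw [if_neg (Ne.symm hx), if_neg hx, mul_zero]⟩
  obtain ⟨r, dims, p, hp, hinj, B, e, he⟩ :=
    exists_eq_submatrix_blockDiagonal' (fun x : Σ i, Fin (m i) => φ x.1) _ hM
  let b' := b.reindex ε
  refine ⟨q, hq, (Pi.basisFun _ (Fin d)).toMatrix b', ?_, r, dims, p, fun j => ?_, hinj, B,
    ε.symm.trans e, ?_⟩
  · have := (Pi.basisFun (LaurentSeries ℂ) (Fin d)).invertibleToMatrix b'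
    exact isUnit_of_invertible _
  · obtain ⟨x, hx⟩ := hp j
    rw [hx, hφ]
  · have h1 := linearMap_toMatrix_mul_basis_toMatrix b' (Pi.basisFun _ (Fin d))
      (Pi.basisFun _ (Fin d)) (Matrix.toLin' (A.map (ramify q hq)))
    have h2 := basis_toMatrix_mul_linearMap_toMatrix b' (Pi.basisFun _ (Fin d)) b'
      (Matrix.toLin' (A.map (ramify q hq)))
    have h3 : LinearMap.toMatrix b' b' (Matrix.toLin' (A.map (ramify q hq))) =
        (LinearMap.toMatrix b b (Matrix.toLin' (A.map (ramify q hq)))).submatrix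
          ε.symm ε.symm := by
      ext1 x y
      simp [LinearMap.toMatrix_apply, b']
    rw [h3, he, Matrix.submatrix_submatrix, ← h1] at h2
    rw [LinearMap.toMatrix_eq_toMatrix', LinearMap.toMatrix'_toLin'] at h2
    exact h2.symm

end
end
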